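/- arXiv:2012.09226 — 3 statements merged into one kernel-verified Lean document; each statement's English description precedes it below -/
import Mathlib

section
/- Let (X, d) be a metric space, G a connected simple graph on a finite vertex set V with shortest-path distance d_G, and γ > 0. Let ρ₀, ρ₁ be finitely supported probability distributions on X × V with atoms (ν₀^i, q₀^i) of mass p₀^i and (ν₁^j, q₁^j) of mass p₁^j, and let π* ∈ Π(p₀, p₁) attain the minimum defining d_{V₁}(ρ₀, ρ₁) = min_π Σ_{i,j} π(i,j)[d(ν₀^i, ν₁^j) + γ d_G(q₀^i, q₁^j)]. For each (i,j) set d̄_{ij} = d_G(q₀^i, q₁^j), choose a shortest path v_{ij}(0) = q₀^i, v_{ij}(1), …, v_{ij}(d̄_{ij}) = q₁^j in G (consecutive vertices adjacent), and choose a curve ν^{ij} : [0,1] → X with ν^{ij}(0) = ν₀^i, ν^{ij}(1) = ν₁^j and d(ν^{ij}(s), ν^{ij}(t)) = (t−s) d(ν₀^i, ν₁^j) for 0 ≤ s ≤ t ≤ 1. For t ∈ [0,1] write a_{ij}(t) = t·d̄_{ij} − ⌊t·d̄_{ij}⌋ and let ρ_t be the finitely supported distribution on X × V placing mass π*(i,j)·(1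 − a_{ij}(t)) at (ν^{ij}(t), v_{ij}(⌊t·d̄_{ij}⌋)) and mass π*(i,j)·a_{ij}(t) at (ν^{ij}(t), v_{ij}(⌊t·d̄_{ij}⌋ + 1)). Then d_{V₁}(ρ_s, ρ_t) = (t−s)·d_{V₁}(ρ₀, ρ₁) for all 0 ≤ s < t ≤ 1; i.e., the displacement interpolation is a constant-speed geodesic for d_{V₁}. -/
open scoped BigOperators

/-- `π` is a coupling of the (finitely supported) probability vectors `p₀` and `p₁`:
it has nonnegative entries, row sums `p₀` and column sums `p₁`. -/
def IsCoupling {ι₀ ι₁ : Type*} [Fintype ι₀] [Fintype ι₁]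
    (p₀ : ι₀ → ℝ) (p₁ : ι₁ → ℝ) (π : ι₀ → ι₁ → ℝ) : Prop :=
  (∀ i j, 0 ≤ π i j) ∧ (∀ i, ∑ j, π i j = p₀ i) ∧ (∀ j, ∑ i, π i j = p₁ j)

/-- The distance `d_{V₁}` between finitely supported distributions on `X × V`:
`d_{V₁}(ρ₀,ρ₁) = min_{π ∈ Π(p₀,p₁)} Σ_{i,j} π(i,j)[d(ν₀^i,ν₁^j) + γ d_G(q₀^i,q₁^j)]`,
where `d_G` is the shortest-path graph distance on `G`. -/
noncomputable def dV1 {X V : Type*} [MetricSpace X] [Fintype V] (G : SimpleGraph V) (γ : ℝ)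
    {ι₀ ι₁ : Type*} [Fintype ι₀] [Fintype ι₁]
    (ν₀ : ι₀ → X) (q₀ : ι₀ → V) (p₀ : ι₀ → ℝ)
    (ν₁ : ι₁ → X) (q₁ : ι₁ → V) (p₁ : ι₁ → ℝ) : ℝ :=
  sInf {c : ℝ | ∃ π : ι₀ → ι₁ → ℝ, IsCoupling p₀ p₁ π ∧
    c = ∑ i, ∑ j, π i j * (dist (ν₀ i) (ν₁ j) + γ * (G.dist (q₀ i) (q₁ j) : ℝ))}

/-- The mass that linear interpolation at `r ≥ 0` gives to `⌊r⌋₊` (`b = false`) and to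
`⌊r⌋₊ + 1` (`b = true`). -/
noncomputable def interpMass (r : ℝ) (b : Bool) : ℝ :=
  if b then r - (⌊r⌋₊ : ℝ) else 1 - (r - (⌊r⌋₊ : ℝ))

/-- The two integers neighbouring `r ≥ 0`. -/
noncomputable def interpIndex (r : ℝ) (b : Bool) : ℕ :=
  ⌊r⌋₊ + if b then 1 else 0

lemma interpMass_nonneg {r : ℝ} (hr : 0 ≤ r) (b : Bool) : 0 ≤ interpMass r b := by
  have h1 := Nat.floor_le hr
  have h2 := Nat.lt_floor_add_one r
  cases b <;> simp [interpMass] <;> linarith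

lemma sum_interpMass (r : ℝ) : ∑ b, interpMass r b = 1 := by
  simp [interpMass]

lemma sum_interpMass_mul_interpIndex (r : ℝ) :
    ∑ b, interpMass r b * (interpIndex r b : ℝ) = r := by
  simp [interpMass, interpIndex]
  ring

lemma interpIndex_le {r : ℝ} {n : ℕ} (hr : 0 ≤ r) (hrn : r ≤ n) {b : Bool}
    (h : interpMass r b ≠ 0) : interpIndex r b ≤ n := by
  have h1 := Nat.floor_le hr
  cases b
  · simpa [interpIndex] using Nat.floor_le_of_le hrn
  · have h2 : (⌊r⌋₊ : ℝ) < n := by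
      simp only [interpMass, if_true] at h
      exact (lt_of_le_of_ne h1 fun h' => h (by linarith)).trans_le hrn
    simpa [interpIndex] using Nat.succ_le_of_lt (by exact_mod_cast h2)

lemma exists_monotone_interp_coupling {r r' : ℝ} (hr : 0 ≤ r) (hrr' : r ≤ r') :
    ∃ κ : Bool → Bool → ℝ, IsCoupling (interpMass r) (interpMass r') κ ∧
      ∀ b b', κ b b' ≠ 0 → interpIndex r b ≤ interpIndex r' b' := by
  have hfl : ⌊r⌋₊ ≤ ⌊r'⌋₊ := Nat.floor_mono hrr'
  rcases hfl.eq_or_lt with heq | hlt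
  · have h1 := Nat.floor_le hr
    have h2 := Nat.lt_floor_add_one r'
    have hR : (⌊r⌋₊ : ℝ) = ⌊r'⌋₊ := by exact_mod_cast heq
    refine ⟨fun b b' => if b then (if b' then r - ⌊r⌋₊ else 0)
      else (if b' then r' - r else 1 - (r' - ⌊r'⌋₊)), ⟨?_, ?_, ?_⟩, ?_⟩
    · rintro (_ | _) (_ | _) <;> simp <;> linarith
    · rintro (_ | _) <;> simp [interpMass, hR]
      ring
    · rintro (_ | _) <;> simp [interpMass, hR]
    · rintro (_ | _) (_ | _) <;> simp [interpIndex, heq]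
  · refine ⟨fun b b' => interpMass r b * interpMass r' b', ⟨?_, ?_, ?_⟩, ?_⟩
    · exact fun b b' => mul_nonneg (interpMass_nonneg hr b) (interpMass_nonneg (hr.trans hrr') b')
    · intro b
      rw [← Finset.mul_sum, sum_interpMass, mul_one]
    · intro b'
      rw [← Finset.sum_mul, sum_interpMass, one_mul]
    · rintro (_ | _) (_ | _) - <;> simp [interpIndex] <;> omega

section Coupling

variable {α β : Type*} [Fintype α] [Fintype β] {p : α → ℝ} {p' : β → ℝ} {σ : α → β → ℝ}

lemma IsCoupling.left_ne_zero (h : IsCoupling p p' σ) {a : α} {b : β} (hab : σ a b ≠ 0) :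
    p a ≠ 0 := by
  intro h0
  have := (Finset.sum_eq_zero_iff_of_nonneg fun b _ => h.1 a b).1 ((h.2.1 a).trans h0)
  exact hab (this b (Finset.mem_univ b))

lemma IsCoupling.right_ne_zero (h : IsCoupling p p' σ) {a : α} {b : β} (hab : σ a b ≠ 0) :
    p' b ≠ 0 := by
  intro h0
  have := (Finset.sum_eq_zero_iff_of_nonneg fun a _ => h.1 a b).1 ((h.2.2 b).trans h0)
  exact hab (this a (Finset.mem_univ a))

lemma IsCoupling.sum_left (h : IsCoupling p p' σ) (f : α → ℝ) :
    ∑ a, ∑ b, σ a b * f a = ∑ a, p a * f a := by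
  simp only [← Finset.sum_mul, h.2.1]

lemma IsCoupling.sum_right (h : IsCoupling p p' σ) (f : β → ℝ) :
    ∑ a, ∑ b, σ a b * f b = ∑ b, p' b * f b := by
  rw [Finset.sum_comm]
  simp only [← Finset.sum_mul, h.2.2]

end Coupling

lemma SimpleGraph.dist_le_sub_of_adj_succ {V : Type*} {G : SimpleGraph V} (hG : G.Connected)
    {v : ℕ → V} {n : ℕ} (hv : ∀ k < n, G.Adj (v k) (v (k + 1))) {k l : ℕ} (hkl : k ≤ l)
    (hl : l ≤ n) : (G.dist (v k) (v l) : ℝ) ≤ (l : ℝ) - k := by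
  induction l, hkl using Nat.le_induction with
  | base => simp
  | succ l hkl ih =>
    have h1 := ih (by omega)
    have h2 : G.dist (v k) (v (l + 1)) ≤ G.dist (v k) (v l) + G.dist (v l) (v (l + 1)) :=
      hG.dist_triangle
    rw [SimpleGraph.dist_eq_one_iff_adj.2 (hv l (by omega))] at h2
    have h3 : (G.dist (v k) (v (l + 1)) : ℝ) ≤ G.dist (v k) (v l) + 1 := by exact_mod_cast h2
    push_cast
    linarith

section Interpolation

variable {ι₀ ι₁ : Type*} [Fintype ι₀] [Fintype ι₁]

lemma sum_mul_interpMass (π r : ι₀ → ι₁ → ℝ) (f g : ι₀ → ι₁ → ℝ) :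
    ∑ z : ι₀ × ι₁ × Bool, (π z.1 z.2.1 * interpMass (r z.1 z.2.1) z.2.2) *
        (f z.1 z.2.1 + g z.1 z.2.1 * (interpIndex (r z.1 z.2.1) z.2.2 : ℝ)) =
      ∑ i, ∑ j, π i j * (f i j + g i j * r i j) := by
  rw [Fintype.sum_prod_type]
  refine Finset.sum_congr rfl fun i _ => ?_
  rw [Fintype.sum_prod_type]
  refine Finset.sum_congr rfl fun j _ => ?_
  have h1 := sum_interpMass (r i j)
  have h2 := sum_interpMass_mul_interpIndex (r i j)
  rw [Fintype.sum_bool] at h1 h2 ⊢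
  dsimp only
  linear_combination (π i j * f i j) * h1 + (π i j * g i j) * h2

/-- A coupling of two interpolants induces a coupling of the end points, by remembering the
initial point of the first one and the final point of the second one. -/
lemma IsCoupling.of_interp {p₀ : ι₀ → ℝ} {p₁ : ι₁ → ℝ} {π r r' : ι₀ → ι₁ → ℝ}
    (hπ : IsCoupling p₀ p₁ π) {σ : ι₀ × ι₁ × Bool → ι₀ × ι₁ × Bool → ℝ}
    (hσ : IsCoupling (fun z => π z.1 z.2.1 * interpMass (r z.1 z.2.1) z.2.2)
      (fun z => π z.1 z.2.1 * interpMass (r' z.1 z.2.1) z.2.2) σ) :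
    ∃ τ, IsCoupling p₀ p₁ τ ∧ ∀ c : ι₀ → ι₁ → ℝ,
      ∑ i, ∑ j, τ i j * c i j = ∑ z, ∑ z', σ z z' * c z.1 z'.2.1 := by
  refine ⟨fun i j => ∑ y : ι₁ × Bool, ∑ i', ∑ b', σ (i, y) (i', j, b'), ⟨?_, ?_, ?_⟩, ?_⟩
  · intro i j
    exact Finset.sum_nonneg fun _ _ => Finset.sum_nonneg fun _ _ => Finset.sum_nonneg fun _ _ =>
      hσ.1 _ _
  · intro i
    rw [Finset.sum_comm, ← hπ.2.1 i, Fintype.sum_prod_type]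
    refine Finset.sum_congr rfl fun j _ => ?_
    have h : ∀ b, ∑ j', ∑ i', ∑ b', σ (i, j, b) (i', j', b') = π i j * interpMass (r i j) b := by
      intro b
      rw [Finset.sum_comm]
      refine Eq.trans ?_ (hσ.2.1 (i, j, b))
      simp only [Fintype.sum_prod_type]
    simp only [h]
    rw [← Finset.mul_sum, sum_interpMass, mul_one]
  · intro j
    rw [← hπ.2.2 j]
    have h : ∀ i' b', ∑ i, ∑ y : ι₁ × Bool, σ (i, y) (i', j, b') =
        π i' j * interpMass (r' i' j) b' := by
      intro i' b'
      refine Eq.trans ?_ (hσ.2.2 (i', j, b'))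
      rw [Fintype.sum_prod_type]
    have h' : ∑ i, ∑ y : ι₁ × Bool, ∑ i', ∑ b', σ (i, y) (i', j, b') =
        ∑ i', ∑ b', ∑ i, ∑ y : ι₁ × Bool, σ (i, y) (i', j, b') := by
      simp only [← Fintype.sum_prod_type' (fun i y => ∑ i', ∑ b', σ (i, y) (i', j, b')),
        ← Fintype.sum_prod_type' (fun i y => σ (i, y) (_, j, _))]
      rw [Finset.sum_comm]
      exact Finset.sum_congr rfl fun _ _ => Finset.sum_comm
    rw [h']
    simp only [h, ← Finset.mul_sum, sum_interpMass, mul_one]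
  · intro c
    rw [Fintype.sum_prod_type]
    refine Finset.sum_congr rfl fun i _ => ?_
    simp only [Finset.sum_mul]
    rw [Finset.sum_comm]
    refine Finset.sum_congr rfl fun y _ => ?_
    rw [Finset.sum_comm]
    simp only [Fintype.sum_prod_type]

/-- Couplings of the fibres of two interpolants along each transport ray assemble to a coupling
of the interpolants. -/
lemma IsCoupling.exists_interp {p₀ : ι₀ → ℝ} {p₁ : ι₁ → ℝ} {π r r' : ι₀ → ι₁ → ℝ}
    (hπ : IsCoupling p₀ p₁ π) {κ : ι₀ → ι₁ → Bool → Bool → ℝ}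
    (hκ : ∀ i j, IsCoupling (interpMass (r i j)) (interpMass (r' i j)) (κ i j)) :
    ∃ σ, IsCoupling (fun z : ι₀ × ι₁ × Bool => π z.1 z.2.1 * interpMass (r z.1 z.2.1) z.2.2)
        (fun z : ι₀ × ι₁ × Bool => π z.1 z.2.1 * interpMass (r' z.1 z.2.1) z.2.2) σ ∧
      ∀ z z', σ z z' ≠ 0 → z'.1 = z.1 ∧ z'.2.1 = z.2.1 ∧ κ z.1 z.2.1 z.2.2 z'.2.2 ≠ 0 := by
  classical
  refine ⟨fun z z' => if z'.1 = z.1 then if z'.2.1 = z.2.1 then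
    π z.1 z.2.1 * κ z.1 z.2.1 z.2.2 z'.2.2 else 0 else 0, ⟨?_, ?_, ?_⟩, ?_⟩
  · intro z z'
    dsimp only
    split_ifs
    exacts [mul_nonneg (hπ.1 _ _) ((hκ _ _).1 _ _), le_rfl, le_rfl]
  · rintro ⟨i, j, b⟩
    simp only [Fintype.sum_prod_type]
    rw [Finset.sum_eq_single i (by intro i' _ h; simp [h]) (by simp),
      Finset.sum_eq_single j (by intro j' _ h; simp [h]) (by simp)]
    simp only [if_true, ← Finset.mul_sum, (hκ i j).2.1]
  · rintro ⟨i, j, b⟩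
    simp only [Fintype.sum_prod_type]
    rw [Finset.sum_eq_single i (by intro i' _ h; simp [h.symm]) (by simp),
      Finset.sum_eq_single j (by intro j' _ h; simp [h.symm]) (by simp)]
    simp only [if_true, ← Finset.mul_sum, (hκ i j).2.2]
  · intro z z' h
    dsimp only at h
    split_ifs at h with h1 h2
    exacts [⟨h1, h2, right_ne_zero_of_mul h⟩, absurd rfl h, absurd rfl h]

end Interpolation

/-- the displacement interpolation for `d_{V₁}` is a constant-speed geodesic.
For each pair `(i,j)` we are given a shortest path `v i j` in `G` from `q₀^i` to `q₁^j`
(of length exactly `d̄_{ij} = d_G(q₀^i,q₁^j)`, consecutive vertices adjacent) and a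
constant-speed curve `ν i j` in `X` from `ν₀^i` to `ν₁^j`.  At time `t`, writing
`a_{ij}(t) = t·d̄_{ij} − ⌊t·d̄_{ij}⌋`, the interpolant `ρ_t` places mass
`π*(i,j)(1 − a_{ij}(t))` at `(ν i j t, v i j ⌊t·d̄_{ij}⌋)` and mass `π*(i,j)·a_{ij}(t)`
at `(ν i j t, v i j (⌊t·d̄_{ij}⌋+1))`.  Then `d_{V₁}(ρ_s,ρ_t) = (t−s)·d_{V₁}(ρ₀,ρ₁)`. -/
theorem dV1_displacement_interpolation_is_geodesic
    {X V : Type*} [MetricSpace X] [Fintype V]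
    (G : SimpleGraph V) (hG : G.Connected) (γ : ℝ) (hγ : 0 < γ)
    {ι₀ ι₁ : Type*} [Fintype ι₀] [Fintype ι₁]
    (ν₀ : ι₀ → X) (q₀ : ι₀ → V) (p₀ : ι₀ → ℝ)
    (ν₁ : ι₁ → X) (q₁ : ι₁ → V) (p₁ : ι₁ → ℝ)
    (hp₀ : ∀ i, 0 < p₀ i) (hs₀ : ∑ i, p₀ i = 1)
    (hp₁ : ∀ j, 0 < p₁ j) (hs₁ : ∑ j, p₁ j = 1)
    (πopt : ι₀ → ι₁ → ℝ)
    (hπ : IsCoupling p₀ p₁ πopt)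
    (hmin : ∀ π : ι₀ → ι₁ → ℝ, IsCoupling p₀ p₁ π →
      ∑ i, ∑ j, πopt i j * (dist (ν₀ i) (ν₁ j) + γ * (G.dist (q₀ i) (q₁ j) : ℝ)) ≤
        ∑ i, ∑ j, π i j * (dist (ν₀ i) (ν₁ j) + γ * (G.dist (q₀ i) (q₁ j) : ℝ)))
    -- a shortest path in `G` from `q₀^i` to `q₁^j` for each pair `(i,j)`
    (v : ι₀ → ι₁ → ℕ → V)
    (hv0 : ∀ i j, v i j 0 = q₀ i)
    (hv1 : ∀ i j, v i j (G.dist (q₀ i) (q₁ j)) = q₁ j)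
    (hvadj : ∀ i j k, k < G.dist (q₀ i) (q₁ j) → G.Adj (v i j k) (v i j (k + 1)))
    -- a constant-speed curve in `X` from `ν₀^i` to `ν₁^j` for each pair `(i,j)`
    (ν : ι₀ → ι₁ → ℝ → X)
    (hν0 : ∀ i j, ν i j 0 = ν₀ i) (hν1 : ∀ i j, ν i j 1 = ν₁ j)
    (hspeed : ∀ i j, ∀ s t : ℝ, 0 ≤ s → s ≤ t → t ≤ 1 →
      dist (ν i j s) (ν i j t) = (t - s) * dist (ν₀ i) (ν₁ j))
    (s t : ℝ) (hs : 0 ≤ s) (hst : s < t) (ht : t ≤ 1) :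
    dV1 G γ
      (fun z : ι₀ × ι₁ × Bool => ν z.1 z.2.1 s)
      (fun z : ι₀ × ι₁ × Bool =>
        v z.1 z.2.1 (⌊s * (G.dist (q₀ z.1) (q₁ z.2.1) : ℝ)⌋₊ + if z.2.2 then 1 else 0))
      (fun z : ι₀ × ι₁ × Bool =>
        πopt z.1 z.2.1 *
          (if z.2.2 then
              s * (G.dist (q₀ z.1) (q₁ z.2.1) : ℝ) - (⌊s * (G.dist (q₀ z.1) (q₁ z.2.1) : ℝ)⌋₊ : ℝ)
            else
              1 - (s * (G.dist (q₀ z.1) (q₁ z.2.1) : ℝ)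
                - (⌊s * (G.dist (q₀ z.1) (q₁ z.2.1) : ℝ)⌋₊ : ℝ))))
      (fun z : ι₀ × ι₁ × Bool => ν z.1 z.2.1 t)
      (fun z : ι₀ × ι₁ × Bool =>
        v z.1 z.2.1 (⌊t * (G.dist (q₀ z.1) (q₁ z.2.1) : ℝ)⌋₊ + if z.2.2 then 1 else 0))
      (fun z : ι₀ × ι₁ × Bool =>
        πopt z.1 z.2.1 *
          (if z.2.2 then
              t * (G.dist (q₀ z.1) (q₁ z.2.1) : ℝ) - (⌊t * (G.dist (q₀ z.1) (q₁ z.2.1) : ℝ)⌋₊ : ℝ)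
            else
              1 - (t * (G.dist (q₀ z.1) (q₁ z.2.1) : ℝ)
                - (⌊t * (G.dist (q₀ z.1) (q₁ z.2.1) : ℝ)⌋₊ : ℝ))))
      = (t - s) * dV1 G γ ν₀ q₀ p₀ ν₁ q₁ p₁ := by
  set d : ι₀ → ι₁ → ℕ := fun i j => G.dist (q₀ i) (q₁ j) with hd
  set C := ∑ i, ∑ j, πopt i j * (dist (ν₀ i) (ν₁ j) + γ * (d i j : ℝ)) with hC
  have hC' : dV1 G γ ν₀ q₀ p₀ ν₁ q₁ p₁ = C := by
    refine IsLeast.csInf_eq ⟨⟨πopt, hπ, rfl⟩, ?_⟩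
    rintro c ⟨π, hπ', rfl⟩
    exact hmin π hπ'
  have ht0 : 0 ≤ t := hs.trans hst.le
  have hs1 : s ≤ 1 := hst.le.trans ht
  have hd0 : ∀ i j, (0 : ℝ) ≤ d i j := fun i j => Nat.cast_nonneg _
  have hsd0 : ∀ i j, 0 ≤ s * (d i j : ℝ) := fun i j => mul_nonneg hs (hd0 i j)
  have htd0 : ∀ i j, 0 ≤ t * (d i j : ℝ) := fun i j => mul_nonneg ht0 (hd0 i j)
  have hsd : ∀ i j, s * (d i j : ℝ) ≤ d i j := fun i j => mul_le_of_le_one_left (hd0 i j) hs1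
  have htd : ∀ i j, t * (d i j : ℝ) ≤ d i j := fun i j => mul_le_of_le_one_left (hd0 i j) ht
  have hpath : ∀ i j {k l : ℕ}, k ≤ l → l ≤ d i j →
      (G.dist (v i j k) (v i j l) : ℝ) ≤ (l : ℝ) - k := fun i j _ _ hkl hl =>
    SimpleGraph.dist_le_sub_of_adj_succ hG (hvadj i j) hkl hl
  let mass : ℝ → ι₀ × ι₁ × Bool → ℝ := fun u z =>
    πopt z.1 z.2.1 * interpMass (u * (d z.1 z.2.1 : ℝ)) z.2.2
  let idx : ℝ → ι₀ × ι₁ × Bool → ℕ := fun u z => interpIndex (u * (d z.1 z.2.1 : ℝ)) z.2.2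
  let D : ι₀ × ι₁ × Bool → ℝ := fun z => dist (ν₀ z.1) (ν₁ z.2.1)
  have hfrom : ∀ u, ∑ z, mass u z * (u * D z + γ * idx u z) = u * C := by
    intro u
    refine (sum_mul_interpMass πopt (fun i j => u * (d i j : ℝ))
      (fun i j => u * dist (ν₀ i) (ν₁ j)) (fun _ _ => γ)).trans ?_
    simp only [hC, Finset.mul_sum]
    refine Finset.sum_congr rfl fun i _ => Finset.sum_congr rfl fun j _ => by ring
  have hto : ∀ u, ∑ z, mass u z * ((1 - u) * D z + γ * (d z.1 z.2.1 - idx u z)) =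
      (1 - u) * C := by
    intro u
    have h := sum_mul_interpMass πopt (fun i j => u * (d i j : ℝ))
      (fun i j => (1 - u) * dist (ν₀ i) (ν₁ j) + γ * d i j) (fun _ _ => -γ)
    trans ∑ i, ∑ j, πopt i j *
      (((1 - u) * dist (ν₀ i) (ν₁ j) + γ * d i j) + -γ * (u * (d i j : ℝ)))
    · rw [← h]
      exact Finset.sum_congr rfl fun z _ => by simp only [mass, idx, D]; ring
    · simp only [hC, Finset.mul_sum]
      exact Finset.sum_congr rfl fun i _ => Finset.sum_congr rfl fun j _ => by ring
  let cost : ι₀ × ι₁ × Bool → ι₀ × ι₁ × Bool → ℝ := fun z z' =>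
    dist (ν z.1 z.2.1 s) (ν z'.1 z'.2.1 t) +
      γ * (G.dist (v z.1 z.2.1 (idx s z)) (v z'.1 z'.2.1 (idx t z')) : ℝ)
  have hlower : ∀ σ, IsCoupling (mass s) (mass t) σ →
      (t - s) * C ≤ ∑ z, ∑ z', σ z z' * cost z z' := by
    intro σ hσ
    obtain ⟨τ, hτ, hτc⟩ := hπ.of_interp
      (r := fun i j => s * (d i j : ℝ)) (r' := fun i j => t * (d i j : ℝ)) hσ
    have h1 : C ≤ _ := hmin τ hτ
    rw [hτc fun i j => dist (ν₀ i) (ν₁ j) + γ * (G.dist (q₀ i) (q₁ j) : ℝ)] at h1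
    have h2 : ∑ z, ∑ z', σ z z' *
          (dist (ν₀ z.1) (ν₁ z'.2.1) + γ * (G.dist (q₀ z.1) (q₁ z'.2.1) : ℝ)) ≤
        ∑ z, ∑ z', (σ z z' * (s * D z + γ * idx s z) + σ z z' * cost z z' +
          σ z z' * ((1 - t) * D z' + γ * (d z'.1 z'.2.1 - idx t z'))) := by
      refine Finset.sum_le_sum fun z _ => Finset.sum_le_sum fun z' _ => ?_
      rw [← mul_add, ← mul_add]
      by_cases h0 : σ z z' = 0
      · simp [h0]
      refine mul_le_mul_of_nonneg_left ?_ (hσ.1 z z')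
      have hz : idx s z ≤ d z.1 z.2.1 := interpIndex_le (hsd0 _ _) (hsd _ _)
        (right_ne_zero_of_mul (hσ.left_ne_zero h0))
      have hz' : idx t z' ≤ d z'.1 z'.2.1 := interpIndex_le (htd0 _ _) (htd _ _)
        (right_ne_zero_of_mul (hσ.right_ne_zero h0))
      have e1 := hspeed z.1 z.2.1 0 s le_rfl hs hs1
      have e2 := hspeed z'.1 z'.2.1 t 1 ht0 ht le_rfl
      rw [hν0] at e1
      rw [hν1] at e2
      have e3 := dist_triangle4 (ν₀ z.1) (ν z.1 z.2.1 s) (ν z'.1 z'.2.1 t) (ν₁ z'.2.1)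
      have g1 := hpath z.1 z.2.1 (Nat.zero_le _) hz
      have g2 := hpath z'.1 z'.2.1 hz' le_rfl
      rw [hv0] at g1
      rw [hv1] at g2
      have g3 : (G.dist (q₀ z.1) (q₁ z'.2.1) : ℝ) ≤ G.dist (q₀ z.1) (v z.1 z.2.1 (idx s z)) +
          G.dist (v z.1 z.2.1 (idx s z)) (v z'.1 z'.2.1 (idx t z')) +
          G.dist (v z'.1 z'.2.1 (idx t z')) (q₁ z'.2.1) := by
        exact_mod_cast (hG.dist_triangle (v := v z'.1 z'.2.1 (idx t z'))).trans
          (Nat.add_le_add_right hG.dist_triangle _)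
      have g4 : (G.dist (q₀ z.1) (q₁ z'.2.1) : ℝ) ≤ idx s z +
          G.dist (v z.1 z.2.1 (idx s z)) (v z'.1 z'.2.1 (idx t z')) +
          (d z'.1 z'.2.1 - idx t z') := by
        push_cast at g1
        linarith
      have g5 := mul_le_mul_of_nonneg_left g4 hγ.le
      simp only [cost, D]
      linarith
    simp only [Finset.sum_add_distrib] at h2
    rw [hσ.sum_left fun z => s * D z + γ * idx s z, hfrom,
      hσ.sum_right fun z' => (1 - t) * D z' + γ * (d z'.1 z'.2.1 - idx t z'), hto] at h2
    linarith
  have hupper : ∃ σ, IsCoupling (mass s) (mass t) σ ∧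
      ∑ z, ∑ z', σ z z' * cost z z' ≤ (t - s) * C := by
    choose κ hκ hκmono using fun i j => exists_monotone_interp_coupling (hsd0 i j)
      (mul_le_mul_of_nonneg_right hst.le (hd0 i j))
    obtain ⟨σ, hσ, hσκ⟩ := hπ.exists_interp hκ
    refine ⟨σ, hσ, ?_⟩
    have h2 : ∑ z, ∑ z', σ z z' * cost z z' ≤
        ∑ z, ∑ z', (σ z z' * (t * D z' + γ * idx t z') - σ z z' * (s * D z + γ * idx s z)) := by
      refine Finset.sum_le_sum fun z _ => Finset.sum_le_sum fun z' _ => ?_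
      rw [← mul_sub]
      by_cases h0 : σ z z' = 0
      · simp [h0]
      refine mul_le_mul_of_nonneg_left ?_ (hσ.1 z z')
      have hz' : idx t z' ≤ d z'.1 z'.2.1 := interpIndex_le (htd0 _ _) (htd _ _)
        (right_ne_zero_of_mul (hσ.right_ne_zero h0))
      obtain ⟨i, j, b⟩ := z
      obtain ⟨i', j', b'⟩ := z'
      obtain ⟨rfl, rfl, hne⟩ := hσκ _ _ h0
      have g := mul_le_mul_of_nonneg_left (hpath _ _ (hκmono _ _ _ _ hne) hz') hγ.le
      have e := hspeed i' j' s t hs hst.le ht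
      simp only [cost, D, idx] at g e ⊢
      linarith
    simp only [Finset.sum_sub_distrib] at h2
    rw [hσ.sum_left fun z => s * D z + γ * idx s z, hfrom,
      hσ.sum_right fun z' => t * D z' + γ * idx t z', hfrom] at h2
    linarith
  rw [hC']
  obtain ⟨σ, hσ, hσc⟩ := hupper
  refine IsLeast.csInf_eq ⟨⟨σ, hσ, (le_antisymm hσc (hlower σ hσ)).symm⟩, ?_⟩
  rintro c ⟨σ', hσ', rfl⟩
  exact hlower σ' hσ'
end

section
/- Let (X, d_X) and (Y, d_Y) be metric spaces and γ > 0. Let ρ₀, ρ₁ be finitely supported probability distributions on X × Y with atoms (ν_k^i, q_k^i) of mass p_k^i, and let π* attain the minimum defining d_{V₂}(ρ₀, ρ₁)² = min_{π ∈ Π(p₀,p₁)} Σ_{i,j} π(i,j)[ d_X(ν₀^i, ν₁^j)² + γ·d_Y(q₀^i, q₁^j)² ]. Suppose for each pair (i,j) there are curves ν^{ij} : [0,1] → X and q^{ij} : [0,1] → Y with ν^{ij}(0) = ν₀^i, ν^{ij}(1) = ν₁^j, q^{ij}(0) = q₀^i, q^{ij}(1) = q₁^j, and d_X(ν^{ij}(s),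 ν^{ij}(t)) = (t−s)·d_X(ν₀^i, ν₁^j) and d_Y(q^{ij}(s), q^{ij}(t)) = (t−s)·d_Y(q₀^i, q₁^j) for all 0 ≤ s ≤ t ≤ 1. For t ∈ [0,1] let ρ_t be the finitely supported distribution placing mass π*(i,j) at (ν^{ij}(t), q^{ij}(t)). Then d_{V₂}(ρ_s, ρ_t) = (t−s)·d_{V₂}(ρ₀, ρ₁) for all 0 ≤ s < t ≤ 1. -/
open scoped BigOperators

/-- The distance `d_{V₂}` between finitely supported distributions on a product `X × Y`
of two metric spaces:
`d_{V₂}(ρ₀,ρ₁) = sqrt( min_{π ∈ Π(p₀,p₁)} Σ_{i,j} π(i,j)[d_X(ν₀^i,ν₁^j)² + γ d_Y(q₀^i,q₁^j)²] )`. -/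
noncomputable def dV2 {X Y : Type*} [MetricSpace X] [MetricSpace Y] (γ : ℝ)
    {ι₀ ι₁ : Type*} [Fintype ι₀] [Fintype ι₁]
    (ν₀ : ι₀ → X) (q₀ : ι₀ → Y) (p₀ : ι₀ → ℝ)
    (ν₁ : ι₁ → X) (q₁ : ι₁ → Y) (p₁ : ι₁ → ℝ) : ℝ :=
  Real.sqrt (sInf {c : ℝ | ∃ π : ι₀ → ι₁ → ℝ, IsCoupling p₀ p₁ π ∧
    c = ∑ i, ∑ j, π i j * (dist (ν₀ i) (ν₁ j) ^ 2 + γ * dist (q₀ i) (q₁ j) ^ 2)})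

/-- A coupling attaining the minimal transport cost computes `dV2`. -/
theorem dV2_eq_sqrt_of_optimal {X Y : Type*} [MetricSpace X] [MetricSpace Y] {γ : ℝ}
    {ι₀ ι₁ : Type*} [Fintype ι₀] [Fintype ι₁]
    {ν₀ : ι₀ → X} {q₀ : ι₀ → Y} {p₀ : ι₀ → ℝ} {ν₁ : ι₁ → X} {q₁ : ι₁ → Y} {p₁ : ι₁ → ℝ}
    {π : ι₀ → ι₁ → ℝ} (hπ : IsCoupling p₀ p₁ π)
    (hmin : ∀ σ : ι₀ → ι₁ → ℝ, IsCoupling p₀ p₁ σ →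
      ∑ i, ∑ j, π i j * (dist (ν₀ i) (ν₁ j) ^ 2 + γ * dist (q₀ i) (q₁ j) ^ 2) ≤
        ∑ i, ∑ j, σ i j * (dist (ν₀ i) (ν₁ j) ^ 2 + γ * dist (q₀ i) (q₁ j) ^ 2)) :
    dV2 γ ν₀ q₀ p₀ ν₁ q₁ p₁ =
      √(∑ i, ∑ j, π i j * (dist (ν₀ i) (ν₁ j) ^ 2 + γ * dist (q₀ i) (q₁ j) ^ 2)) := by
  unfold dV2
  congr 1
  refine IsLeast.csInf_eq ⟨⟨π, hπ, rfl⟩, ?_⟩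
  rintro _ ⟨σ, hσ, rfl⟩
  exact hmin σ hσ

namespace IsCoupling

variable {α β : Type*} [Fintype α] [Fintype β] {p₀ : α → ℝ} {p₁ : β → ℝ} {σ : α → β → ℝ}

theorem sum_mul_left (hσ : IsCoupling p₀ p₁ σ) (f : α → ℝ) :
    ∑ a, ∑ b, σ a b * f a = ∑ a, p₀ a * f a := by
  simp_rw [← Finset.sum_mul, hσ.2.1]

theorem sum_mul_right (hσ : IsCoupling p₀ p₁ σ) (f : β → ℝ) :
    ∑ a, ∑ b, σ a b * f b = ∑ b, p₁ b * f b := by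
  rw [Finset.sum_comm]
  simp_rw [← Finset.sum_mul, hσ.2.2]

/-- The diagonal coupling of a nonnegative vector with itself. -/
theorem diagonal [DecidableEq α] {p : α → ℝ} (hp : ∀ a, 0 ≤ p a) :
    IsCoupling p p (fun a b => if a = b then p a else 0) := by
  refine ⟨fun a b => ?_, fun a => by simp, fun b => by simp⟩
  dsimp only
  split_ifs
  exacts [hp a, le_rfl]

/-- The coupling of the outer marginals induced by a coupling of two couplings. -/
theorem outer {α' β' : Type*} [Fintype α'] [Fintype β']
    {p₀' : α' → ℝ} {p₁' : β' → ℝ} {π : α → β → ℝ} {π' : α' → β' → ℝ}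
    (hπ : IsCoupling p₀ p₁ π) (hπ' : IsCoupling p₀' p₁' π') {σ : α × β → α' × β' → ℝ}
    (hσ : IsCoupling (fun a => π a.1 a.2) (fun b => π' b.1 b.2) σ) :
    IsCoupling p₀ p₁' (fun i l => ∑ j, ∑ k, σ (i, j) (k, l)) := by
  refine ⟨fun i l => Finset.sum_nonneg fun j _ => Finset.sum_nonneg fun k _ => hσ.1 _ _,
    fun i => ?_, fun l => ?_⟩
  · rw [← hπ.2.1 i, Finset.sum_comm]
    refine Finset.sum_congr rfl fun j _ => ?_
    exact (Fintype.sum_prod_type_right _).symm.trans (hσ.2.1 (i, j))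
  · rw [← hπ'.2.2 l, ← Fintype.sum_prod_type' (fun i j => ∑ k, σ (i, j) (k, l)),
      Finset.sum_comm]
    exact Finset.sum_congr rfl fun k _ => hσ.2.2 (k, l)

end IsCoupling

/-- Jensen's inequality for the square, applied to a three-leg triangle inequality. -/
theorem mul_sq_le_of_le_add_add {e u d v s w r : ℝ} (he : 0 ≤ e) (hs : 0 ≤ s) (hw : 0 < w)
    (hr : 0 ≤ r) (hsum : s + w + r = 1) (h : e ≤ s * u + d + r * v) :
    w * e ^ 2 ≤ w * s * u ^ 2 + d ^ 2 + w * r * v ^ 2 := by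
  obtain ⟨m, rfl⟩ : ∃ m, d = w * m := ⟨d / w, by field_simp⟩
  have hsq : e ^ 2 ≤ (s * u + w * m + r * v) ^ 2 := by gcongr
  have hjensen : (s * u + w * m + r * v) ^ 2 ≤ s * u ^ 2 + w * m ^ 2 + r * v ^ 2 := by
    obtain rfl : s = 1 - w - r := by linarith
    nlinarith [mul_nonneg (mul_nonneg hs hw.le) (sq_nonneg (u - m)),
      mul_nonneg (mul_nonneg hs hr) (sq_nonneg (u - v)),
      mul_nonneg (mul_nonneg hw.le hr) (sq_nonneg (m - v))]
  linarith [mul_le_mul_of_nonneg_left (hsq.trans hjensen) hw.le]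

/-- Comparison of distances between points of two constant-speed curves and between the
starting point of the first and the endpoint of the second. -/
theorem mul_dist_sq_le_of_constant_speed {Z : Type*} [PseudoMetricSpace Z] {f g : ℝ → Z}
    (hf : ∀ s t : ℝ, 0 ≤ s → s ≤ t → t ≤ 1 → dist (f s) (f t) = (t - s) * dist (f 0) (f 1))
    (hg : ∀ s t : ℝ, 0 ≤ s → s ≤ t → t ≤ 1 → dist (g s) (g t) = (t - s) * dist (g 0) (g 1))
    {s t : ℝ} (hs : 0 ≤ s) (hst : s < t) (ht : t ≤ 1) :
    (t - s) * dist (f 0) (g 1) ^ 2 ≤ (t - s) * s * dist (f 0) (f 1) ^ 2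
      + dist (f s) (g t) ^ 2 + (t - s) * (1 - t) * dist (g 0) (g 1) ^ 2 := by
  refine mul_sq_le_of_le_add_add dist_nonneg hs (sub_pos.2 hst) (sub_nonneg.2 ht) (by ring) ?_
  have hleft := hf 0 s le_rfl hs (hst.le.trans ht)
  have hright := hg t 1 (hs.trans hst.le) ht le_rfl
  rw [sub_zero] at hleft
  rw [← hleft, ← hright]
  exact dist_triangle4 _ _ _ _

/-- if `π*` attains the minimum defining `d_{V₂}(ρ₀,ρ₁)²` and each pair of
atoms is joined by constant-speed curves `ν i j` in `X` and `q i j` in `Y`, then the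
interpolation `ρ_t` placing mass `π*(i,j)` at `(ν i j t, q i j t)` satisfies
`d_{V₂}(ρ_s,ρ_t) = (t−s)·d_{V₂}(ρ₀,ρ₁)` for `0 ≤ s < t ≤ 1`. -/
theorem dV2_displacement_interpolation_is_geodesic
    {X Y : Type*} [MetricSpace X] [MetricSpace Y] (γ : ℝ) (hγ : 0 < γ)
    {ι₀ ι₁ : Type*} [Fintype ι₀] [Fintype ι₁]
    (ν₀ : ι₀ → X) (q₀ : ι₀ → Y) (p₀ : ι₀ → ℝ)
    (ν₁ : ι₁ → X) (q₁ : ι₁ → Y) (p₁ : ι₁ → ℝ)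
    (hp₀ : ∀ i, 0 < p₀ i) (hs₀ : ∑ i, p₀ i = 1)
    (hp₁ : ∀ j, 0 < p₁ j) (hs₁ : ∑ j, p₁ j = 1)
    (πopt : ι₀ → ι₁ → ℝ)
    (hπ : IsCoupling p₀ p₁ πopt)
    (hmin : ∀ π : ι₀ → ι₁ → ℝ, IsCoupling p₀ p₁ π →
      ∑ i, ∑ j, πopt i j * (dist (ν₀ i) (ν₁ j) ^ 2 + γ * dist (q₀ i) (q₁ j) ^ 2) ≤
        ∑ i, ∑ j, π i j * (dist (ν₀ i) (ν₁ j) ^ 2 + γ * dist (q₀ i) (q₁ j) ^ 2))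
    (ν : ι₀ → ι₁ → ℝ → X) (q : ι₀ → ι₁ → ℝ → Y)
    (hν0 : ∀ i j, ν i j 0 = ν₀ i) (hν1 : ∀ i j, ν i j 1 = ν₁ j)
    (hq0 : ∀ i j, q i j 0 = q₀ i) (hq1 : ∀ i j, q i j 1 = q₁ j)
    (hνspeed : ∀ i j, ∀ s t : ℝ, 0 ≤ s → s ≤ t → t ≤ 1 →
      dist (ν i j s) (ν i j t) = (t - s) * dist (ν₀ i) (ν₁ j))
    (hqspeed : ∀ i j, ∀ s t : ℝ, 0 ≤ s → s ≤ t → t ≤ 1 →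
      dist (q i j s) (q i j t) = (t - s) * dist (q₀ i) (q₁ j))
    (s t : ℝ) (hs : 0 ≤ s) (hst : s < t) (ht : t ≤ 1) :
    dV2 γ (fun ij : ι₀ × ι₁ => ν ij.1 ij.2 s) (fun ij : ι₀ × ι₁ => q ij.1 ij.2 s)
        (fun ij : ι₀ × ι₁ => πopt ij.1 ij.2)
        (fun ij : ι₀ × ι₁ => ν ij.1 ij.2 t) (fun ij : ι₀ × ι₁ => q ij.1 ij.2 t)
        (fun ij : ι₀ × ι₁ => πopt ij.1 ij.2)
      = (t - s) * dV2 γ ν₀ q₀ p₀ ν₁ q₁ p₁ := by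
  classical
  have hw : 0 < t - s := sub_pos.2 hst
  set c : ι₀ → ι₁ → ℝ := fun i j => dist (ν₀ i) (ν₁ j) ^ 2 + γ * dist (q₀ i) (q₁ j) ^ 2 with hc
  set C : ℝ := ∑ i, ∑ j, πopt i j * c i j with hC
  have hdiag : IsCoupling (fun a : ι₀ × ι₁ => πopt a.1 a.2) (fun a : ι₀ × ι₁ => πopt a.1 a.2)
      (fun a b => if a = b then πopt a.1 a.2 else 0) := .diagonal fun a => hπ.1 a.1 a.2
  have hcost : ∑ a : ι₀ × ι₁, ∑ b : ι₀ × ι₁, (if a = b then πopt a.1 a.2 else 0) *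
      (dist (ν a.1 a.2 s) (ν b.1 b.2 t) ^ 2 + γ * dist (q a.1 a.2 s) (q b.1 b.2 t) ^ 2)
      = (t - s) ^ 2 * C := by
    simp only [ite_mul, zero_mul, Finset.sum_ite_eq, Finset.mem_univ, if_true]
    rw [Fintype.sum_prod_type, hC, Finset.mul_sum]
    refine Finset.sum_congr rfl fun i _ => ?_
    rw [Finset.mul_sum]
    refine Finset.sum_congr rfl fun j _ => ?_
    rw [hνspeed i j s t hs hst.le ht, hqspeed i j s t hs hst.le ht]
    ring
  rw [dV2_eq_sqrt_of_optimal hπ hmin, dV2_eq_sqrt_of_optimal hdiag, hcost,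
    Real.sqrt_mul (sq_nonneg _), Real.sqrt_sq hw.le]
  intro σ hσ
  rw [hcost]
  set d : ι₀ × ι₁ → ι₀ × ι₁ → ℝ := fun a b =>
    dist (ν a.1 a.2 s) (ν b.1 b.2 t) ^ 2 + γ * dist (q a.1 a.2 s) (q b.1 b.2 t) ^ 2 with hd
  have hpoint (a b : ι₀ × ι₁) : (t - s) * c a.1 b.2 ≤
      (t - s) * s * c a.1 a.2 + d a b + (t - s) * (1 - t) * c b.1 b.2 := by
    have hX := mul_dist_sq_le_of_constant_speed (f := ν a.1 a.2) (g := ν b.1 b.2)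
      (by simpa only [hν0, hν1] using hνspeed a.1 a.2)
      (by simpa only [hν0, hν1] using hνspeed b.1 b.2) hs hst ht
    have hY := mul_dist_sq_le_of_constant_speed (f := q a.1 a.2) (g := q b.1 b.2)
      (by simpa only [hq0, hq1] using hqspeed a.1 a.2)
      (by simpa only [hq0, hq1] using hqspeed b.1 b.2) hs hst ht
    simp only [hν0, hν1, hq0, hq1] at hX hY
    simp only [hc, hd]
    linarith [mul_le_mul_of_nonneg_left hY hγ.le]
  have houter : C ≤ ∑ a, ∑ b, σ a b * c a.1 b.2 := by
    refine (hmin _ (hπ.outer hπ hσ)).trans_eq ?_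
    simp only [Fintype.sum_prod_type_right (f := fun b : ι₀ × ι₁ => σ _ b * c _ b.2),
      Fintype.sum_prod_type (f := fun a : ι₀ × ι₁ => ∑ l, ∑ k, σ a (k, l) * c a.1 l),
      Finset.sum_mul]
    exact Finset.sum_congr rfl fun i _ => Finset.sum_comm
  have hleft : ∑ a, ∑ b, σ a b * c a.1 a.2 = C :=
    (hσ.sum_mul_left fun a => c a.1 a.2).trans (Fintype.sum_prod_type _)
  have hright : ∑ a, ∑ b, σ a b * c b.1 b.2 = C :=
    (hσ.sum_mul_right fun b => c b.1 b.2).trans (Fintype.sum_prod_type _)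
  have hsum : (t - s) * ∑ a, ∑ b, σ a b * c a.1 b.2 ≤
      (t - s) * s * ∑ a, ∑ b, σ a b * c a.1 a.2 + ∑ a, ∑ b, σ a b * d a b
        + (t - s) * (1 - t) * ∑ a, ∑ b, σ a b * c b.1 b.2 := by
    simp only [Finset.mul_sum, ← Finset.sum_add_distrib]
    refine Finset.sum_le_sum fun a _ => Finset.sum_le_sum fun b _ => ?_
    linarith [mul_le_mul_of_nonneg_left (hpoint a b) (hσ.1 a b)]
  rw [hleft, hright] at hsum
  linarith [mul_le_mul_of_nonneg_left houter hw.le]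
end

section
/- Let μ₀, μ₁ be Borel probability measures on ℝ^N with finite second moments, let α₀ be a Borel probability measure on ℝ with finite second moment, let c ∈ ℝ, and let α₁ be the pushforward of α₀ under z ↦ z + c. Then the infimum over all couplings π of μ₀ ⊗ α₀ and μ₁ ⊗ α₁ of ∫ (‖x − y‖² + |z − w|²) dπ((x,z),(y,w)) equals W₂(μ₀, μ₁)² + c², where W₂(μ₀, μ₁)² denotes the infimum over couplings π₁ of (μ₀, μ₁) of ∫ ‖x − y‖² dπ₁(x,y). -/
open MeasureTheory
open scoped ENNReal

/-- Jensen's inequality for the quadratic cost of a coupling of two real random variables. -/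
theorem ofReal_sq_integral_sub_le_lintegral {Ω : Type*} [MeasurableSpace Ω] {π : Measure Ω}
    [IsProbabilityMeasure π] {Z W : Ω → ℝ} (hZ : MemLp Z 2 π) (hW : MemLp W 2 π) :
    ENNReal.ofReal ((∫ p, W p ∂π - ∫ p, Z p ∂π) ^ 2) ≤
      ∫⁻ p, ENNReal.ofReal (|Z p - W p| ^ 2) ∂π := by
  have hZi : Integrable Z π := hZ.integrable one_le_two
  have hWi : Integrable W π := hW.integrable one_le_two
  have hsq : Integrable (fun p => |Z p - W p| ^ 2) π := by
    simpa only [sq_abs, Pi.sub_apply] using (hZ.sub hW).integrable_sq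
  rw [← integral_sub hWi hZi, ← ofReal_integral_eq_lintegral_ofReal hsq
    (ae_of_all _ fun p => by positivity)]
  apply ENNReal.ofReal_le_ofReal
  set m := ∫ p, (W p - Z p) ∂π with hm
  have hdiff : Integrable (fun p => W p - Z p) π := hWi.sub hZi
  have haff : Integrable (fun p => 2 * m * (W p - Z p) - m ^ 2) π :=
    (hdiff.const_mul _).sub (integrable_const _)
  have hle : ∫ p, (2 * m * (W p - Z p) - m ^ 2) ∂π ≤ ∫ p, |Z p - W p| ^ 2 ∂π := by
    refine integral_mono haff hsq fun p => ?_
    simp only [sq_abs]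
    nlinarith [sq_nonneg (W p - Z p - m)]
  rw [integral_sub (hdiff.const_mul _) (integrable_const _), integral_const_mul, ← hm,
    integral_const, probReal_univ, one_smul] at hle
  linarith

/-- transport cost between "Gaussian cylinders" on a single chart: let
`μ₀, μ₁` be Borel probability measures on `ℝ^N` with finite second moments, `α₀` a Borel
probability measure on `ℝ` with finite second moment, and `α₁` its pushforward by
`z ↦ z + c`.  Then the optimal quadratic transport cost between the product measures
`μ₀ ⊗ α₀` and `μ₁ ⊗ α₁` (for the cost `‖x − y‖² + |z − w|²`) equals `W₂(μ₀,μ₁)² + c²`,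
where `W₂(μ₀,μ₁)²` is the infimal quadratic transport cost between `μ₀` and `μ₁`. -/
theorem cylinder_coupling_cost
    (N : ℕ)
    (μ₀ μ₁ : Measure (EuclideanSpace ℝ (Fin N))) (α₀ α₁ : Measure ℝ)
    [IsProbabilityMeasure μ₀] [IsProbabilityMeasure μ₁] [IsProbabilityMeasure α₀]
    (hμ₀ : Integrable (fun x => ‖x‖ ^ 2) μ₀) (hμ₁ : Integrable (fun x => ‖x‖ ^ 2) μ₁)
    (hα₀ : Integrable (fun z => z ^ 2) α₀)
    (c : ℝ) (hα₁ : α₁ = α₀.map (fun z => z + c)) :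
    sInf {e : ℝ≥0∞ |
        ∃ π : Measure ((EuclideanSpace ℝ (Fin N) × ℝ) × (EuclideanSpace ℝ (Fin N) × ℝ)),
          π.map Prod.fst = μ₀.prod α₀ ∧ π.map Prod.snd = μ₁.prod α₁ ∧
          e = ∫⁻ p, ENNReal.ofReal (‖p.1.1 - p.2.1‖ ^ 2 + |p.1.2 - p.2.2| ^ 2) ∂π} =
    sInf {e : ℝ≥0∞ |
        ∃ π₁ : Measure (EuclideanSpace ℝ (Fin N) × EuclideanSpace ℝ (Fin N)),
          π₁.map Prod.fst = μ₀ ∧ π₁.map Prod.snd = μ₁ ∧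
          e = ∫⁻ p, ENNReal.ofReal (‖p.1 - p.2‖ ^ 2) ∂π₁} +
    ENNReal.ofReal (c ^ 2) := by
  subst hα₁
  have hshift : Measurable fun z : ℝ => z + c := by fun_prop
  have : IsProbabilityMeasure (α₀.map fun z => z + c) :=
    Measure.isProbabilityMeasure_map hshift.aemeasurable
  apply le_antisymm
  · rw [ENNReal.sInf_add]
    refine le_iInf₂ ?_
    rintro _ ⟨π₁, h0, h1, rfl⟩
    have : IsProbabilityMeasure π₁ := by
      have : IsProbabilityMeasure (π₁.map Prod.fst) := by rwa [h0]
      exact Measure.isProbabilityMeasure_of_map Prod.fst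
    have hT : Measurable fun q : (EuclideanSpace ℝ (Fin N) × EuclideanSpace ℝ (Fin N)) × ℝ =>
        ((q.1.1, q.2), (q.1.2, q.2 + c)) := by fun_prop
    refine sInf_le ⟨(π₁.prod α₀).map fun q => ((q.1.1, q.2), (q.1.2, q.2 + c)), ?_, ?_, ?_⟩
    · rw [Measure.map_map measurable_fst hT, ← h0]
      conv_rhs => rw [← Measure.map_id (μ := α₀)]
      exact (Measure.map_prod_map _ _ measurable_fst measurable_id).symm
    · rw [Measure.map_map measurable_snd hT, ← h1]
      exact (Measure.map_prod_map _ _ measurable_snd hshift).symm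
    · rw [lintegral_map (by fun_prop) hT]
      have hcost (q : (EuclideanSpace ℝ (Fin N) × EuclideanSpace ℝ (Fin N)) × ℝ) :
          ENNReal.ofReal (‖q.1.1 - q.1.2‖ ^ 2 + |q.2 - (q.2 + c)| ^ 2) =
            ENNReal.ofReal (‖q.1.1 - q.1.2‖ ^ 2) + ENNReal.ofReal (c ^ 2) := by
        rw [ENNReal.ofReal_add (by positivity) (by positivity), sq_abs]
        ring_nf
      simp_rw [hcost]
      rw [lintegral_add_right _ measurable_const, lintegral_const, measure_univ, mul_one,
        lintegral_prod _ (by fun_prop)]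
      simp
  · refine le_sInf ?_
    rintro _ ⟨π, h0, h1, rfl⟩
    have : IsProbabilityMeasure π := by
      have : IsProbabilityMeasure (π.map Prod.fst) := by rw [h0]; infer_instance
      exact Measure.isProbabilityMeasure_of_map Prod.fst
    have hsplit (p : (EuclideanSpace ℝ (Fin N) × ℝ) × (EuclideanSpace ℝ (Fin N) × ℝ)) :
        ENNReal.ofReal (‖p.1.1 - p.2.1‖ ^ 2 + |p.1.2 - p.2.2| ^ 2) =
          ENNReal.ofReal (‖p.1.1 - p.2.1‖ ^ 2) + ENNReal.ofReal (|p.1.2 - p.2.2| ^ 2) :=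
      ENNReal.ofReal_add (by positivity) (by positivity)
    simp_rw [hsplit]
    rw [lintegral_add_left (by fun_prop)]
    have hmarg : Measurable fun p : (EuclideanSpace ℝ (Fin N) × ℝ) ×
        (EuclideanSpace ℝ (Fin N) × ℝ) => (p.1.1, p.2.1) := by fun_prop
    gcongr
    · refine sInf_le ⟨π.map fun p => (p.1.1, p.2.1), ?_, ?_, ?_⟩
      · rw [Measure.map_map measurable_fst hmarg]
        change π.map (Prod.fst ∘ Prod.fst) = _
        rw [← Measure.map_map measurable_fst measurable_fst, h0, Measure.map_fst_prod]
        simp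
      · rw [Measure.map_map measurable_snd hmarg]
        change π.map (Prod.fst ∘ Prod.snd) = _
        rw [← Measure.map_map measurable_fst measurable_snd, h1, Measure.map_fst_prod]
        simp
      · rw [lintegral_map (by fun_prop) hmarg]
    · have hlaw₀ : MeasurePreserving (fun p => p.1.2) π α₀ :=
        measurePreserving_snd.comp ⟨measurable_fst, h0⟩
      have hlaw₁ : MeasurePreserving (fun p => p.2.2) π (α₀.map fun z => z + c) :=
        measurePreserving_snd.comp ⟨measurable_snd, h1⟩
      have hid : MemLp (fun z : ℝ => z) 2 α₀ :=
        (memLp_two_iff_integrable_sq measurable_id.aestronglyMeasurable).2 hα₀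
      have hadd : MemLp (fun z : ℝ => z + c) 2 α₀ := hid.add (memLp_const c)
      have hid₁ : MemLp (fun z : ℝ => z) 2 (α₀.map fun z => z + c) :=
        (memLp_map_measure_iff measurable_id.aestronglyMeasurable hshift.aemeasurable).2 hadd
      have key := ofReal_sq_integral_sub_le_lintegral
        (hid.comp_measurePreserving hlaw₀) (hid₁.comp_measurePreserving hlaw₁)
      have e₀ : ∫ p, p.1.2 ∂π = ∫ z, z ∂α₀ := by
        rw [← hlaw₀.map_eq, integral_map (f := fun z : ℝ => z) hlaw₀.aemeasurable
          measurable_id.aestronglyMeasurable]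
      have e₁ : ∫ p, p.2.2 ∂π = ∫ z, z ∂α₀ + c := by
        rw [← integral_map (f := fun z : ℝ => z) hlaw₁.aemeasurable
          measurable_id.aestronglyMeasurable, hlaw₁.map_eq,
          integral_map (f := fun z : ℝ => z) hshift.aemeasurable
            measurable_id.aestronglyMeasurable,
          integral_add (hid.integrable one_le_two) (integrable_const c)]
        simp
      simpa only [Function.comp_def, e₀, e₁, add_sub_cancel_left] using key
end
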